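/- arXiv:2005.14426 — 2 statements merged into one kernel-verified Lean document; each statement's English description precedes it below -/
import Mathlib

section
/- Fix samples (x₁,y₁),…,(xₙ,yₙ) with ‖xᵢ‖₂ ≤ B_X for all i and a vector v with ‖v‖₂ ≤ 1. Suppose σ is non-decreasing and L-Lipschitz (σ' a fixed choice of (sub)derivative with 0 ≤ σ' ≤ L), and assume F̂(v) ∈ (0,1). Let gradient descent with step size η ≤ (1/4)·L⁻²·B_X⁻² be initialized at w₀ = 0. Then there exists t < T := ⌈η⁻¹·L⁻¹·B_X⁻¹·F̂(v)^{−1/2}⌉ such that Ĥ(w_t) ≤ 2·L²·B_X·F̂(v)^{1/2}, and moreover ‖w_s − v‖₂ ≤ 1 for every s ≤ t. -/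
open MeasureTheory Real
open scoped InnerProductSpace ENNReal

set_option maxHeartbeats 2000000 in
lemma step_aux {d n : ℕ} (hn : 0 < n)
    (x : Fin n → EuclideanSpace ℝ (Fin d)) (y : Fin n → ℝ)
    (σ σ' : ℝ → ℝ) (L B η p H : ℝ)
    (hσmono : Monotone σ) (hL : 0 < L)
    (hσlip : ∀ z₁ z₂ : ℝ, |σ z₁ - σ z₂| ≤ L * |z₁ - z₂|)
    (hσ'nonneg : ∀ z, 0 ≤ σ' z) (hσ'le : ∀ z, σ' z ≤ L)
    (hB : 0 < B) (hx : ∀ i, ‖x i‖ ≤ B)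
    (w v : EuclideanSpace ℝ (Fin d)) (hwv : ‖w - v‖ ≤ 1) (hp : 0 < p)
    (hE : ∑ i, (σ ⟪v, x i⟫_ℝ - y i) ^ 2 = 2 * n * p ^ 2)
    (hH : ∑ i, (σ ⟪w, x i⟫_ℝ - σ ⟪v, x i⟫_ℝ) ^ 2 * σ' ⟪w, x i⟫_ℝ = 2 * n * H)
    (hη : 0 < η) (hηle : η * (4 * L ^ 2 * B ^ 2) ≤ 1)
    (hlarge : 2 * L ^ 2 * B * p < H) :
    ‖(w - (η / (n : ℝ)) •
      ∑ i, ((σ ⟪w, x i⟫_ℝ - y i) * σ' ⟪w, x i⟫_ℝ) • x i) - v‖ ^ 2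
      ≤ ‖w - v‖ ^ 2 - 2 * η * L * B * p := by
  have hN : (0 : ℝ) < n := by exact_mod_cast hn
  set D := ∑ i, ((σ ⟪w, x i⟫_ℝ - y i) * σ' ⟪w, x i⟫_ℝ) • x i with hD
  have hz : ∀ i, |⟪w, x i⟫_ℝ - ⟪v, x i⟫_ℝ| ≤ B := by
    intro i
    rw [← inner_sub_left]
    calc _ ≤ ‖w - v‖ * ‖x i‖ := abs_real_inner_le_norm _ _
      _ ≤ 1 * B := by gcongr; exact hx i
      _ = B := one_mul B
  -- bound on the sum of noise terms
  have hEabs : ∑ i, |σ ⟪v, x i⟫_ℝ - y i| ≤ 3 / 2 * n * p := by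
    have h := sq_sum_le_card_mul_sum_sq (s := Finset.univ)
      (f := fun i => |σ ⟪v, x i⟫_ℝ - y i|)
    simp only [sq_abs, hE, Finset.card_univ, Fintype.card_fin] at h
    apply abs_le_of_sq_le_sq' _ (by positivity) |>.2
    nlinarith [sq_nonneg ((n : ℝ) * p)]
  -- inner product
  have hI : 2 * n * H / L - L * B * (3 / 2 * n * p) ≤ ⟪w - v, D⟫_ℝ := by
    have h1 : ⟪w - v, D⟫_ℝ = ∑ i, ((σ ⟪w, x i⟫_ℝ - y i) * σ' ⟪w, x i⟫_ℝ) *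
        (⟪w, x i⟫_ℝ - ⟪v, x i⟫_ℝ) := by
      rw [hD, inner_sum]
      refine Finset.sum_congr rfl fun i _ => ?_
      rw [inner_smul_right, inner_sub_left]
    have h2 : ∑ i, ((σ ⟪w, x i⟫_ℝ - σ ⟪v, x i⟫_ℝ) ^ 2 * σ' ⟪w, x i⟫_ℝ / L
        - L * B * |σ ⟪v, x i⟫_ℝ - y i|) ≤ ⟪w - v, D⟫_ℝ := by
      rw [h1]
      refine Finset.sum_le_sum fun i _ => ?_
      have hzi := hz i
      generalize ⟪w, x i⟫_ℝ = a at *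
      generalize ⟪v, x i⟫_ℝ = b at *
      have hs := hσ'nonneg a
      have hs' := hσ'le a
      have hl := hσlip a b
      have k1 : (σ a - σ b) ^ 2 ≤ L * ((σ a - σ b) * (a - b)) := by
        rcases le_total a b with hab | hab
        · have := hσmono hab
          rw [abs_of_nonpos (by linarith), abs_of_nonpos (by linarith)] at hl
          nlinarith
        · have := hσmono hab
          rw [abs_of_nonneg (by linarith), abs_of_nonneg (by linarith)] at hl
          nlinarith
      have k2 : (σ a - σ b) ^ 2 * σ' a / L ≤ (σ a - σ b) * (a - b) * σ' a := by
        rw [div_le_iff₀ hL]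
        nlinarith [mul_le_mul_of_nonneg_right k1 hs]
      have k3 : |(σ b - y i) * σ' a * (a - b)| ≤ L * B * |σ b - y i| := by
        rw [abs_mul, abs_mul, abs_of_nonneg hs]
        calc _ ≤ |σ b - y i| * L * B := by gcongr
          _ = _ := by ring
      have k4 := neg_abs_le ((σ b - y i) * σ' a * (a - b))
      nlinarith
    rw [Finset.sum_sub_distrib, ← Finset.sum_div, ← Finset.mul_sum, hH] at h2
    have : L * B * ∑ i, |σ ⟪v, x i⟫_ℝ - y i| ≤ L * B * (3 / 2 * n * p) := by gcongr
    linarith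
  have hDn : ‖D‖ ^ 2 ≤ 4 * n ^ 2 * B ^ 2 * (L * H + L ^ 2 * p ^ 2) := by
    have h1 : ‖D‖ ≤ B * ∑ i, |(σ ⟪w, x i⟫_ℝ - y i) * σ' ⟪w, x i⟫_ℝ| := by
      rw [hD, Finset.mul_sum]
      refine norm_sum_le_of_le _ fun i _ => ?_
      rw [norm_smul, Real.norm_eq_abs, mul_comm]
      gcongr
      exact hx i
    have h2 := sq_sum_le_card_mul_sum_sq (s := Finset.univ)
      (f := fun i => |(σ ⟪w, x i⟫_ℝ - y i) * σ' ⟪w, x i⟫_ℝ|)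
    simp only [sq_abs, Finset.card_univ, Fintype.card_fin] at h2
    have h3 : ∑ i, ((σ ⟪w, x i⟫_ℝ - y i) * σ' ⟪w, x i⟫_ℝ) ^ 2 ≤
        ∑ i, (2 * L * ((σ ⟪w, x i⟫_ℝ - σ ⟪v, x i⟫_ℝ) ^ 2 * σ' ⟪w, x i⟫_ℝ)
          + 2 * L ^ 2 * (σ ⟪v, x i⟫_ℝ - y i) ^ 2) := by
      refine Finset.sum_le_sum fun i _ => ?_
      generalize ⟪w, x i⟫_ℝ = a
      generalize ⟪v, x i⟫_ℝ = b
      have hs := hσ'nonneg a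
      have hs' := hσ'le a
      have j1 : (σ a - y i) ^ 2 ≤ 2 * (σ a - σ b) ^ 2 + 2 * (σ b - y i) ^ 2 := by
        nlinarith [sq_nonneg ((σ a - σ b) - (σ b - y i))]
      have j2 : σ' a ^ 2 ≤ L * σ' a := by nlinarith
      have j3 : σ' a ^ 2 ≤ L ^ 2 := by gcongr
      rw [mul_pow]
      nlinarith [mul_le_mul_of_nonneg_right j1 (sq_nonneg (σ' a)),
        mul_le_mul_of_nonneg_left j2 (sq_nonneg (σ a - σ b)),
        mul_le_mul_of_nonneg_left j3 (sq_nonneg (σ b - y i))]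
    rw [Finset.sum_add_distrib, ← Finset.mul_sum, ← Finset.mul_sum, hH, hE] at h3
    calc ‖D‖ ^ 2 ≤ (B * ∑ i, |(σ ⟪w, x i⟫_ℝ - y i) * σ' ⟪w, x i⟫_ℝ|) ^ 2 := by gcongr
      _ = B ^ 2 * (∑ i, |(σ ⟪w, x i⟫_ℝ - y i) * σ' ⟪w, x i⟫_ℝ|) ^ 2 := by rw [mul_pow]
      _ ≤ B ^ 2 * (n * (2 * L * (2 * n * H) + 2 * L ^ 2 * (2 * n * p ^ 2))) := by
        gcongr
        exact h2.trans (by gcongr)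
      _ = _ := by ring
  have hHub : H ≤ L ^ 3 * B ^ 2 / 2 := by
    have h1 : ∑ i, (σ ⟪w, x i⟫_ℝ - σ ⟪v, x i⟫_ℝ) ^ 2 * σ' ⟪w, x i⟫_ℝ
        ≤ ∑ i : Fin n, (L * B) ^ 2 * L := by
      refine Finset.sum_le_sum fun i _ => ?_
      have q : (σ ⟪w, x i⟫_ℝ - σ ⟪v, x i⟫_ℝ) ^ 2 ≤ (L * B) ^ 2 := by
        rw [← sq_abs]
        gcongr
        exact (hσlip _ _).trans (by gcongr; exact hz i)
      exact mul_le_mul q (hσ'le _) (hσ'nonneg _) (by positivity)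
    rw [hH] at h1
    simp only [Finset.sum_const, Finset.card_univ, Fintype.card_fin, nsmul_eq_mul] at h1
    have : (n : ℝ) * (2 * H) ≤ n * ((L * B) ^ 2 * L) := by linarith
    have := le_of_mul_le_mul_left this hN
    linarith
  have hpub : p ≤ L * B / 4 := by
    have : (2 * L ^ 2 * B) * p ≤ (2 * L ^ 2 * B) * (L * B / 4) := by linarith
    exact le_of_mul_le_mul_left this (by positivity)
  obtain ⟨h, rfl⟩ : ∃ h, H = L * h := ⟨H / L, by field_simp⟩
  have hh : 2 * L * B * p < h := by
    have : L * (2 * L * B * p) < L * h := by linarith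
    exact lt_of_mul_lt_mul_left this hL.le
  have e : w - (η / (n : ℝ)) • D - v = (w - v) - (η / (n : ℝ)) • D := by abel
  rw [e, norm_sub_sq_real, inner_smul_right, norm_smul, mul_pow, Real.norm_eq_abs, sq_abs]
  have hI' : 2 * n * h - L * B * (3 / 2 * n * p) ≤ ⟪w - v, D⟫_ℝ := by
    convert hI using 2
    field_simp
  have f1 : η * (2 * h - 3 / 2 * L * B * p) ≤ η / n * ⟪w - v, D⟫_ℝ := by
    calc _ = η / n * (2 * n * h - L * B * (3 / 2 * n * p)) := by field_simp
      _ ≤ _ := by gcongr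
  have f2 : (η / n) ^ 2 * ‖D‖ ^ 2 ≤ η * (h + p ^ 2) := by
    have hh0 : 0 ≤ h := le_trans (by positivity) hh.le
    calc _ ≤ (η / n) ^ 2 * (4 * n ^ 2 * B ^ 2 * (L * (L * h) + L ^ 2 * p ^ 2)) := by gcongr
      _ = (η * (4 * L ^ 2 * B ^ 2)) * (η * (h + p ^ 2)) := by field_simp
      _ ≤ 1 * (η * (h + p ^ 2)) := by gcongr
      _ = _ := one_mul _
  have f3 : p ^ 2 ≤ L * B * p / 4 := by nlinarith
  have f4 : 2 * L * B * p ≤ 2 * (2 * h - 3 / 2 * L * B * p) - (h + p ^ 2) := by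
    have : 0 < L * B * p := by positivity
    linarith
  nlinarith [mul_le_mul_of_nonneg_left f4 hη.le]

/-- Lemma: agnostic key lemma, general non-decreasing Lipschitz
activations, incl. ReLU. Fix samples with `‖xᵢ‖ ≤ B_X` and `‖v‖ ≤ 1`; `σ` non-decreasing
and `L`-Lipschitz with (sub)derivative `σ'` satisfying `0 ≤ σ' ≤ L`; `F̂(v) ∈ (0,1)`.
Gradient descent on the empirical risk with step size `η ≤ (1/4)·L⁻²·B_X⁻²` initialized
at `w₀ = 0` finds some `t < T = ⌈η⁻¹·L⁻¹·B_X⁻¹·F̂(v)^{−1/2}⌉` with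
`Ĥ(w_t) ≤ 2·L²·B_X·F̂(v)^{1/2}`, and `‖w_s − v‖ ≤ 1` for every `s ≤ t`. -/
theorem statement5 {d n : ℕ} (hn : 0 < n)
    (x : Fin n → EuclideanSpace ℝ (Fin d)) (y : Fin n → ℝ)
    (σ σ' : ℝ → ℝ) (L B_X η : ℝ)
    (hσmono : Monotone σ) (hL : 0 < L)
    (hσlip : ∀ z₁ z₂ : ℝ, |σ z₁ - σ z₂| ≤ L * |z₁ - z₂|)
    (hσ'nonneg : ∀ z, 0 ≤ σ' z) (hσ'le : ∀ z, σ' z ≤ L)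
    (hBX : 0 < B_X) (hx : ∀ i, ‖x i‖ ≤ B_X)
    (v : EuclideanSpace ℝ (Fin d)) (hv : ‖v‖ ≤ 1)
    (hFv : (1 / (2 * (n : ℝ))) * ∑ i, (σ ⟪v, x i⟫_ℝ - y i) ^ 2 ∈ Set.Ioo (0 : ℝ) 1)
    (hη : 0 < η) (hηle : η ≤ (1 / 4) * (L ^ 2)⁻¹ * (B_X ^ 2)⁻¹)
    (w : ℕ → EuclideanSpace ℝ (Fin d)) (hw0 : w 0 = 0)
    (hupd : ∀ t : ℕ, w (t + 1) = w t - (η / (n : ℝ)) •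
      ∑ i, ((σ ⟪w t, x i⟫_ℝ - y i) * σ' ⟪w t, x i⟫_ℝ) • x i) :
    ∃ t < ⌈η⁻¹ * L⁻¹ * B_X⁻¹ *
        (Real.sqrt ((1 / (2 * (n : ℝ))) * ∑ i, (σ ⟪v, x i⟫_ℝ - y i) ^ 2))⁻¹⌉₊,
      (1 / (2 * (n : ℝ))) * ∑ i, (σ ⟪w t, x i⟫_ℝ - σ ⟪v, x i⟫_ℝ) ^ 2 * σ' ⟪w t, x i⟫_ℝ ≤
        2 * L ^ 2 * B_X * Real.sqrt ((1 / (2 * (n : ℝ))) * ∑ i, (σ ⟪v, x i⟫_ℝ - y i) ^ 2) ∧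
      ∀ s ≤ t, ‖w s - v‖ ≤ 1 := by
  have hN : (0 : ℝ) < n := by exact_mod_cast hn
  set F := (1 / (2 * (n : ℝ))) * ∑ i, (σ ⟪v, x i⟫_ℝ - y i) ^ 2 with hF
  have hp : 0 < √F := Real.sqrt_pos.2 hFv.1
  have hp2 : √F ^ 2 = F := Real.sq_sqrt hFv.1.le
  have hE : ∑ i, (σ ⟪v, x i⟫_ℝ - y i) ^ 2 = 2 * n * √F ^ 2 := by
    rw [hp2, hF]
    field_simp
  have hηle' : η * (4 * L ^ 2 * B_X ^ 2) ≤ 1 := by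
    calc _ ≤ ((1 / 4) * (L ^ 2)⁻¹ * (B_X ^ 2)⁻¹) * (4 * L ^ 2 * B_X ^ 2) := by gcongr
      _ = 1 := by field_simp
  set p := √F
  by_contra! hcon
  set T := ⌈η⁻¹ * L⁻¹ * B_X⁻¹ * p⁻¹⌉₊ with hT
  have key : ∀ t : ℕ, t ≤ T → ∀ s ≤ t, ‖w s - v‖ ^ 2 ≤ 1 - s * (2 * η * L * B_X * p) := by
    intro t
    induction t with
    | zero =>
      intro _ s hs
      obtain rfl : s = 0 := by omega
      rw [hw0, zero_sub, norm_neg]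
      have := norm_nonneg v
      simp only [Nat.cast_zero, zero_mul, sub_zero]
      nlinarith
    | succ t ih =>
      intro ht s hs
      have ih' := ih (by omega)
      rcases Nat.lt_or_ge s (t + 1) with h | h
      · exact ih' s (by omega)
      obtain rfl : s = t + 1 := by omega
      have hle : ∀ s ≤ t, ‖w s - v‖ ≤ 1 := by
        intro s hs
        have h1 := ih' s hs
        have h2 : 0 ≤ (s : ℝ) * (2 * η * L * B_X * p) := by positivity
        have := norm_nonneg (w s - v)
        nlinarith
      have hlarge : 2 * L ^ 2 * B_X * p < (1 / (2 * (n : ℝ))) *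
          ∑ i, (σ ⟪w t, x i⟫_ℝ - σ ⟪v, x i⟫_ℝ) ^ 2 * σ' ⟪w t, x i⟫_ℝ := by
        by_contra! hc
        obtain ⟨s, hs, hs'⟩ := hcon t (by omega) hc
        exact absurd (hle s hs) (not_le.2 hs')
      have hstep := step_aux hn x y σ σ' L B_X η p _ hσmono hL hσlip hσ'nonneg hσ'le hBX hx
        (w t) v (hle t le_rfl) hp hE (by field_simp) hη hηle' hlarge
      rw [← hupd] at hstep
      have := ih' t le_rfl
      push_cast
      linarith
  have hfin := key T le_rfl T le_rfl
  have hTle : η⁻¹ * L⁻¹ * B_X⁻¹ * p⁻¹ ≤ (T : ℝ) := Nat.le_ceil _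
  have h2 : 2 ≤ (T : ℝ) * (2 * η * L * B_X * p) := by
    calc (2 : ℝ) = (η⁻¹ * L⁻¹ * B_X⁻¹ * p⁻¹) * (2 * η * L * B_X * p) := by field_simp
      _ ≤ _ := by gcongr
  have := sq_nonneg ‖w T - v‖
  linarith
end

section
/- Fix samples (x₁,y₁),…,(xₙ,yₙ) with ‖xᵢ‖₂ ≤ B_X for all i and a vector v with ‖v‖₂ ≤ 1. Suppose σ is non-decreasing and L-Lipschitz (σ' a fixed choice of (sub)derivative with 0 ≤ σ' ≤ L). Suppose there is K with 0 < K ≤ 1 such that for every choice of scalars α₁,…,αₙ ∈ [0,L], ‖(1/n)·Σᵢ (σ(vᵀxᵢ) − yᵢ)·αᵢ·xᵢ‖₂ ≤ K. Then gradient descent on the empirical risk with step size η ≤ (1/4)·L⁻²·B_X⁻² initialized at w₀ = 0 produces some t < T := ⌈η⁻¹·K⁻¹⌉ with Ĥ(w_t) ≤ 4·L·K, and ‖w_s − v‖₂ ≤ 1 for every s ≤ t. -/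
open MeasureTheory Real
open scoped InnerProductSpace ENNReal

lemma aux_step {E : Type*} [NormedAddCommGroup E] [InnerProductSpace ℝ E] {n : ℕ} (hn : 0 < n)
    (x : Fin n → E) (D s : Fin n → ℝ) (L B K η H : ℝ) (u N : E)
    (hL : 0 < L) (hB : 0 < B) (hx : ∀ i, ‖x i‖ ≤ B) (hu : ‖u‖ ≤ 1)
    (hs0 : ∀ i, 0 ≤ s i) (hsL : ∀ i, s i ≤ L)
    (hD1 : ∀ i, D i ^ 2 ≤ L * (D i * ⟪x i, u⟫_ℝ))
    (hD2 : ∀ i, |D i| ≤ L * |⟪x i, u⟫_ℝ|)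
    (hN : ‖N‖ ≤ K) (hK : 0 < K) (hη : 0 < η) (hηle : η ≤ (1 / 4) * (L ^ 2)⁻¹ * (B ^ 2)⁻¹)
    (hH : H = (1 / (2 * (n : ℝ))) * ∑ i, D i ^ 2 * s i) (hbig : 4 * L * K < H) :
    ‖u - η • ((1 / (n : ℝ)) • ∑ i, (D i * s i) • x i + N)‖ ^ 2 ≤ ‖u‖ ^ 2 - 2 * (η * K) := by
  have hn' : (0 : ℝ) < n := by exact_mod_cast hn
  set A : E := (1 / (n : ℝ)) • ∑ i, (D i * s i) • x i with hA
  have hsum : ∑ i, D i ^ 2 * s i = 2 * n * H := by rw [hH]; field_simp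
  have F1 : 2 * H ≤ L * ⟪A, u⟫_ℝ := by
    have h1 : ∑ i, D i ^ 2 * s i ≤ L * ∑ i, (D i * s i) * ⟪x i, u⟫_ℝ := by
      rw [Finset.mul_sum]
      apply Finset.sum_le_sum
      intro i _
      nlinarith [mul_le_mul_of_nonneg_right (hD1 i) (hs0 i)]
    have h2 : ⟪A, u⟫_ℝ = (1 / (n : ℝ)) * ∑ i, (D i * s i) * ⟪x i, u⟫_ℝ := by
      simp only [hA, real_inner_smul_left, sum_inner]
    rw [h2, hsum] at *
    have : L * (1 / (n : ℝ) * ∑ i, (D i * s i) * ⟪x i, u⟫_ℝ)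
        = (L * ∑ i, (D i * s i) * ⟪x i, u⟫_ℝ) / n := by field_simp
    rw [this, le_div_iff₀ hn']
    linarith
  have F2 : ‖A‖ ^ 2 ≤ 2 * L * B ^ 2 * H := by
    have h1 : ‖∑ i, (D i * s i) • x i‖ ≤ ∑ i, |D i| * s i * B := by
      refine (norm_sum_le _ _).trans (Finset.sum_le_sum fun i _ => ?_)
      rw [norm_smul, Real.norm_eq_abs, abs_mul, abs_of_nonneg (hs0 i)]
      exact mul_le_mul_of_nonneg_left (hx i) (mul_nonneg (abs_nonneg _) (hs0 i))
    have h2 : (∑ i, |D i| * s i * B) ^ 2 ≤ n * ∑ i, (|D i| * s i * B) ^ 2 := by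
      have := sq_sum_le_card_mul_sum_sq (s := (Finset.univ : Finset (Fin n)))
        (f := fun i => |D i| * s i * B)
      simpa using this
    have h3 : ∑ i, (|D i| * s i * B) ^ 2 ≤ L * B ^ 2 * ∑ i, D i ^ 2 * s i := by
      rw [Finset.mul_sum]
      apply Finset.sum_le_sum
      intro i _
      have e : (|D i| * s i * B) ^ 2 = (D i ^ 2 * s i * B ^ 2) * s i := by
        rw [mul_pow, mul_pow, sq_abs]; ring
      rw [e]
      have : 0 ≤ D i ^ 2 * s i * B ^ 2 := by have := hs0 i; positivity
      nlinarith [mul_le_mul_of_nonneg_left (hsL i) this]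
    have h4 : ‖∑ i, (D i * s i) • x i‖ ^ 2 ≤ (n : ℝ) ^ 2 * (2 * L * B ^ 2 * H) := by
      calc _ ≤ (∑ i, |D i| * s i * B) ^ 2 := pow_le_pow_left₀ (norm_nonneg _) h1 2
        _ ≤ n * (L * B ^ 2 * (2 * n * H)) := by
          rw [← hsum]; exact h2.trans (mul_le_mul_of_nonneg_left h3 hn'.le)
        _ = _ := by ring
    rw [hA, norm_smul, mul_pow, Real.norm_eq_abs, sq_abs, one_div, inv_pow,
      inv_mul_le_iff₀ (by positivity)]
    exact h4
  have F3 : H ≤ L ^ 3 * B ^ 2 / 2 := by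
    have h1 : ∑ i, D i ^ 2 * s i ≤ ∑ _i : Fin n, (L * B) ^ 2 * L := by
      apply Finset.sum_le_sum
      intro i _
      have h2 : |⟪x i, u⟫_ℝ| ≤ B := by
        have h3 := abs_real_inner_le_norm (x i) u
        have h4 : ‖x i‖ * ‖u‖ ≤ B * 1 := mul_le_mul (hx i) hu (norm_nonneg _) hB.le
        linarith
      have h5 : |D i| ≤ L * B := (hD2 i).trans (mul_le_mul_of_nonneg_left h2 hL.le)
      have h6 : D i ^ 2 ≤ (L * B) ^ 2 := by
        rw [← sq_abs]; exact pow_le_pow_left₀ (abs_nonneg _) h5 2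
      exact mul_le_mul h6 (hsL i) (hs0 i) (by positivity)
    rw [hsum, Finset.sum_const, Finset.card_univ, Fintype.card_fin, nsmul_eq_mul] at h1
    have : 2 * H * n ≤ (L * B) ^ 2 * L * n := by linarith
    have := le_of_mul_le_mul_right this hn'
    nlinarith
  have hηLB : η * (L ^ 2 * B ^ 2) ≤ 1 / 4 := by
    have h1 := mul_le_mul_of_nonneg_right hηle (by positivity : 0 ≤ L ^ 2 * B ^ 2)
    have h2 : 1 / 4 * (L ^ 2)⁻¹ * (B ^ 2)⁻¹ * (L ^ 2 * B ^ 2) = 1 / 4 := by field_simp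
    linarith
  have hK8 : 8 * K ≤ L ^ 2 * B ^ 2 := by
    have : L * (8 * K) ≤ L * (L ^ 2 * B ^ 2) := by nlinarith
    exact le_of_mul_le_mul_left this hL
  have hηK : η * K ≤ 1 / 32 := by nlinarith [mul_le_mul_of_nonneg_left hK8 hη.le]
  have hNu : -K ≤ ⟪N, u⟫_ℝ := by
    have h1 := abs_real_inner_le_norm N u
    have h4 : ‖N‖ * ‖u‖ ≤ K * 1 := mul_le_mul hN hu (norm_nonneg _) hK.le
    have := neg_abs_le ⟪N, u⟫_ℝ
    linarith
  obtain ⟨h, hh⟩ : ∃ h, H = L * h := ⟨H / L, by field_simp⟩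
  have hh4 : 4 * K < h := by
    have : L * (4 * K) < L * h := by rw [← hh]; linarith
    exact lt_of_mul_lt_mul_left this hL.le
  have F1' : 2 * h ≤ ⟪A, u⟫_ℝ := by
    have : L * (2 * h) ≤ L * ⟪A, u⟫_ℝ := by rw [hh] at F1; linarith
    exact le_of_mul_le_mul_left this hL
  have G : ‖A + N‖ ^ 2 ≤ 2 * ‖A‖ ^ 2 + 2 * K ^ 2 := by
    have h1 := norm_add_le A N
    have h2 : ‖A + N‖ ≤ ‖A‖ + K := by linarith
    have h3 := pow_le_pow_left₀ (norm_nonneg _) h2 2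
    nlinarith [sq_nonneg (‖A‖ - K)]
  have G2 : η ^ 2 * ‖A + N‖ ^ 2 ≤ η * h + 2 * (η * K) ^ 2 := by
    have h1 : ‖A + N‖ ^ 2 ≤ 4 * (L ^ 2 * B ^ 2) * h + 2 * K ^ 2 := by
      rw [hh] at F2; linarith
    have h2 := mul_le_mul_of_nonneg_left h1 (sq_nonneg η)
    have h3 : 0 ≤ η * h := mul_nonneg hη.le (by linarith)
    have h4 := mul_le_mul_of_nonneg_right hηLB h3
    nlinarith
  rw [norm_sub_sq_real, norm_smul, mul_pow, Real.norm_eq_abs, sq_abs, real_inner_smul_right,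
    real_inner_comm, inner_add_left]
  have h5 : 2 * (η * (2 * h - K)) ≤ 2 * (η * (⟪A, u⟫_ℝ + ⟪N, u⟫_ℝ)) := by
    have := mul_le_mul_of_nonneg_left (by linarith : 2 * h - K ≤ ⟪A, u⟫_ℝ + ⟪N, u⟫_ℝ) hη.le
    linarith
  have h6 : η * (4 * K) ≤ η * h := mul_le_mul_of_nonneg_left hh4.le hη.le
  have h7 : 0 < η * K := mul_pos hη hK
  nlinarith [mul_le_mul_of_nonneg_right hηK h7.le]

/-- Lemma: noisy-teacher key lemma. Fix samples with `‖xᵢ‖ ≤ B_X` and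
`‖v‖ ≤ 1`; `σ` non-decreasing and `L`-Lipschitz with (sub)derivative `0 ≤ σ' ≤ L`.
Suppose `0 < K ≤ 1` is such that for every choice of scalars `αᵢ ∈ [0, L]`,
`‖(1/n)·Σᵢ (σ(vᵀxᵢ) − yᵢ)·αᵢ·xᵢ‖ ≤ K`. Then gradient descent on the empirical risk with
step size `η ≤ (1/4)·L⁻²·B_X⁻²` initialized at `w₀ = 0` produces some
`t < T = ⌈η⁻¹·K⁻¹⌉` with `Ĥ(w_t) ≤ 4·L·K`, and `‖w_s − v‖ ≤ 1` for every `s ≤ t`. -/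
theorem statement10 {d n : ℕ} (hn : 0 < n)
    (x : Fin n → EuclideanSpace ℝ (Fin d)) (y : Fin n → ℝ)
    (σ σ' : ℝ → ℝ) (L B_X K η : ℝ)
    (hσmono : Monotone σ) (hL : 0 < L)
    (hσlip : ∀ z₁ z₂ : ℝ, |σ z₁ - σ z₂| ≤ L * |z₁ - z₂|)
    (hσ'nonneg : ∀ z, 0 ≤ σ' z) (hσ'le : ∀ z, σ' z ≤ L)
    (hBX : 0 < B_X) (hx : ∀ i, ‖x i‖ ≤ B_X)
    (v : EuclideanSpace ℝ (Fin d)) (hv : ‖v‖ ≤ 1)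
    (hK0 : 0 < K) (hK1 : K ≤ 1)
    (hK : ∀ a : Fin n → ℝ, (∀ i, a i ∈ Set.Icc (0 : ℝ) L) →
      ‖(1 / (n : ℝ)) • ∑ i, ((σ ⟪v, x i⟫_ℝ - y i) * a i) • x i‖ ≤ K)
    (hη : 0 < η) (hηle : η ≤ (1 / 4) * (L ^ 2)⁻¹ * (B_X ^ 2)⁻¹)
    (w : ℕ → EuclideanSpace ℝ (Fin d)) (hw0 : w 0 = 0)
    (hupd : ∀ t : ℕ, w (t + 1) = w t - (η / (n : ℝ)) •
      ∑ i, ((σ ⟪w t, x i⟫_ℝ - y i) * σ' ⟪w t, x i⟫_ℝ) • x i) :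
    ∃ t < ⌈η⁻¹ * K⁻¹⌉₊,
      (1 / (2 * (n : ℝ))) * ∑ i, (σ ⟪w t, x i⟫_ℝ - σ ⟪v, x i⟫_ℝ) ^ 2 * σ' ⟪w t, x i⟫_ℝ ≤
        4 * L * K ∧
      ∀ s ≤ t, ‖w s - v‖ ≤ 1 := by
  by_contra hcon
  push Not at hcon
  have hn' : (0 : ℝ) < n := by exact_mod_cast hn
  have hηK : 0 < η * K := mul_pos hη hK0
  have key : ∀ t ≤ ⌈η⁻¹ * K⁻¹⌉₊, ∀ s ≤ t, ‖w s - v‖ ^ 2 ≤ 1 - 2 * (η * K) * s := by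
    intro t
    induction t with
    | zero =>
      intro _ s hs
      obtain rfl : s = 0 := by omega
      simp only [hw0, zero_sub, norm_neg, Nat.cast_zero, mul_zero, sub_zero]
      exact pow_le_one₀ (norm_nonneg _) hv
    | succ t ih =>
      intro ht s hs
      have ih' := ih (by omega)
      rcases Nat.lt_or_ge t s with h | h
      swap
      · exact ih' s h
      obtain rfl : s = t + 1 := by omega
      have hle : ∀ s ≤ t, ‖w s - v‖ ≤ 1 := by
        intro s hs
        have h1 := ih' s hs
        have h2 : 0 ≤ 2 * (η * K) * s := by positivity
        exact (sq_le_one_iff₀ (norm_nonneg _)).1 (by linarith)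
      have hbig : 4 * L * K < (1 / (2 * (n : ℝ))) *
          ∑ i, (σ ⟪w t, x i⟫_ℝ - σ ⟪v, x i⟫_ℝ) ^ 2 * σ' ⟪w t, x i⟫_ℝ := by
        by_contra hc
        obtain ⟨s, hs, hs'⟩ := hcon t (by omega) (not_lt.1 hc)
        exact absurd (hle s hs) (not_le.2 hs')
      have hin : ∀ i, ⟪x i, w t - v⟫_ℝ = ⟪w t, x i⟫_ℝ - ⟪v, x i⟫_ℝ := by
        intro i
        rw [inner_sub_right, real_inner_comm, real_inner_comm v]
      have st := aux_step hn x (fun i => σ ⟪w t, x i⟫_ℝ - σ ⟪v, x i⟫_ℝ)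
        (fun i => σ' ⟪w t, x i⟫_ℝ) L B_X K η _ (w t - v)
        ((1 / (n : ℝ)) • ∑ i, ((σ ⟪v, x i⟫_ℝ - y i) * σ' ⟪w t, x i⟫_ℝ) • x i)
        hL hBX hx (hle t le_rfl) (fun i => hσ'nonneg _) (fun i => hσ'le _)
        (fun i => by
          rw [hin]
          generalize ⟪w t, x i⟫_ℝ = p
          generalize ⟪v, x i⟫_ℝ = q
          have hl := hσlip p q
          rcases le_total q p with hpq | hpq
          · have := hσmono hpq
            rw [abs_of_nonneg (by linarith), abs_of_nonneg (by linarith)] at hl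
            nlinarith
          · have := hσmono hpq
            rw [abs_of_nonpos (by linarith), abs_of_nonpos (by linarith)] at hl
            nlinarith)
        (fun i => by rw [hin]; exact hσlip _ _)
        (hK _ (fun i => ⟨hσ'nonneg _, hσ'le _⟩)) hK0 hη hηle rfl hbig
      have e : w (t + 1) - v = w t - v - η • ((1 / (n : ℝ)) •
          ∑ i, ((σ ⟪w t, x i⟫_ℝ - σ ⟪v, x i⟫_ℝ) * σ' ⟪w t, x i⟫_ℝ) • x i +
          (1 / (n : ℝ)) • ∑ i, ((σ ⟪v, x i⟫_ℝ - y i) * σ' ⟪w t, x i⟫_ℝ) • x i) := by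
        rw [hupd, ← smul_add, ← Finset.sum_add_distrib, smul_smul, mul_one_div, sub_right_comm]
        congr 2
        apply Finset.sum_congr rfl
        intro i _
        rw [← add_smul]
        congr 1
        ring
      rw [e]
      have := ih' t le_rfl
      push_cast
      linarith
  have h1 := key _ le_rfl _ le_rfl
  have h2 : 1 ≤ η * K * (⌈η⁻¹ * K⁻¹⌉₊ : ℝ) := by
    have h3 := mul_le_mul_of_nonneg_left (Nat.le_ceil (η⁻¹ * K⁻¹)) hηK.le
    have h4 : η * K * (η⁻¹ * K⁻¹) = 1 := by field_simp
    linarith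
  have h3 := sq_nonneg ‖w ⌈η⁻¹ * K⁻¹⌉₊ - v‖
  linarith
end
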